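/- (Thales' theorem in the Euclidean plane.) Let O ∈ ℝ² and r > 0, and let p₁, p₂, p₃ be three pairwise distinct points on the circle of center O and radius r. Let p₄ and p₅ be points of ℝ², each distinct from p₁ and p₂, lying strictly on the same side of the line through p₁ and p₂ as p₃, i.e. det(p₂ − p₁, p₄ − p₁)·det(p₂ − p₁, p₃ − p₁) > 0 and det(p₂ − p₁, p₅ − p₁)·det(p₂ − p₁, p₃ − p₁) > 0, where det((u₁,u₂),(v₁,v₂)) = u₁v₂ − u₂v₁. Assume dist(p₄, O) < r (p₄ is strictly inside the circle) and dist(p₅, O) > r (p₅ is strictly outside the circle). Then the Euclidean angles satisfy ∠ p₁ p₄ p₂ > ∠ p₁ p₃ p₂ > ∠ p₁ p₅ p₂. -/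

import Mathlib

/-- The determinant of two vectors of the Euclidean plane. -/
noncomputable def det2 (u v : EuclideanSpace ℝ (Fin 2)) : ℝ := u 0 * v 1 - u 1 * v 0

theorem div_lt_div_of_mul_lt_mul_of_sq_eq {x y s t A B : ℝ} (hs : 0 < s) (ht : 0 < t)
    (hA : 0 < A) (hB : 0 < B) (hA2 : A ^ 2 = x ^ 2 + s ^ 2) (hB2 : B ^ 2 = y ^ 2 + t ^ 2)
    (h : x * t < y * s) : x / A < y / B := by
  rw [div_lt_div_iff₀ hA hB]
  rcases le_or_gt 0 x with hx | hx
  · have hy : 0 < y := pos_of_mul_pos_left (lt_of_le_of_lt (by positivity) h) hs.le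
    have hsq : (x * t) ^ 2 < (y * s) ^ 2 := pow_lt_pow_left₀ h (by positivity) two_ne_zero
    refine lt_of_pow_lt_pow_left₀ 2 (by positivity) ?_
    rw [mul_pow, mul_pow, hA2, hB2]
    linarith
  · rcases le_or_gt 0 y with hy | hy
    · exact lt_of_lt_of_le (mul_neg_of_neg_of_pos hx hB) (by positivity)
    · have hy' : 0 < -y := neg_pos.2 hy
      have hx' : 0 < -x := neg_pos.2 hx
      have hsq : (-y * s) ^ 2 < (-x * t) ^ 2 :=
        pow_lt_pow_left₀ (by linarith) (by positivity) two_ne_zero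
      have hlt : -y * A < -x * B := by
        refine lt_of_pow_lt_pow_left₀ 2 (by positivity) ?_
        rw [mul_pow, mul_pow, hA2, hB2]
        linarith
      linarith

theorem inner_eq_coords (u v : EuclideanSpace ℝ (Fin 2)) :
    inner ℝ u v = u 0 * v 0 + u 1 * v 1 := by
  simp [PiLp.inner_apply, Fin.sum_univ_two, mul_comm]

theorem norm_sq_eq_coords (u : EuclideanSpace ℝ (Fin 2)) : ‖u‖ ^ 2 = u 0 ^ 2 + u 1 ^ 2 := by
  simp [EuclideanSpace.norm_sq_eq, Fin.sum_univ_two]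

/-- Lagrange's identity in the plane, for the two sides of a triangle that meet at `p`. -/
theorem norm_mul_norm_sq_eq_inner_sq_add_det2_sq (a b p : EuclideanSpace ℝ (Fin 2)) :
    (‖a - p‖ * ‖b - p‖) ^ 2 = inner ℝ (a - p) (b - p) ^ 2 + |det2 (b - a) (p - a)| ^ 2 := by
  rw [mul_pow, norm_sq_eq_coords, norm_sq_eq_coords, inner_eq_coords, sq_abs, det2]
  simp only [PiLp.sub_apply]
  ring

/-- At points off the line `ab`, the angle subtended by `ab` is decreasing in its cotangent. -/
theorem angle_lt_angle_of_inner_mul_abs_det2_lt {a b p q : EuclideanSpace ℝ (Fin 2)}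
    (hp : det2 (b - a) (p - a) ≠ 0) (hq : det2 (b - a) (q - a) ≠ 0)
    (h : inner ℝ (a - p) (b - p) * |det2 (b - a) (q - a)| <
      inner ℝ (a - q) (b - q) * |det2 (b - a) (p - a)|) :
    EuclideanGeometry.angle a q b < EuclideanGeometry.angle a p b := by
  have norm_pos : ∀ z, det2 (b - a) (z - a) ≠ 0 → 0 < ‖a - z‖ * ‖b - z‖ := fun z hz => by
    refine lt_of_le_of_ne (by positivity) fun h0 => ?_
    have hsq := norm_mul_norm_sq_eq_inner_sq_add_det2_sq a b z
    rw [← h0] at hsq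
    nlinarith [abs_pos.2 hz, sq_nonneg (inner ℝ (a - z) (b - z))]
  have hcos := div_lt_div_of_mul_lt_mul_of_sq_eq (abs_pos.2 hp) (abs_pos.2 hq)
    (norm_pos p hp) (norm_pos q hq) (norm_mul_norm_sq_eq_inner_sq_add_det2_sq a b p)
    (norm_mul_norm_sq_eq_inner_sq_add_det2_sq a b q) h
  rw [← InnerProductGeometry.cos_angle, ← InnerProductGeometry.cos_angle] at hcos
  exact (Real.strictAntiOn_cos.lt_iff_gt
    ⟨InnerProductGeometry.angle_nonneg _ _, InnerProductGeometry.angle_le_pi _ _⟩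
    ⟨InnerProductGeometry.angle_nonneg _ _, InnerProductGeometry.angle_le_pi _ _⟩).1 hcos

/-- For `a`, `b` on a circle, the cotangents of the angles subtended by `ab` at two points differ
by the difference of the powers of these points divided by the determinants. -/
theorem inner_sub_power_mul_det2_eq {O a b : EuclideanSpace ℝ (Fin 2)} {r : ℝ}
    (ha : dist a O = r) (hb : dist b O = r) (p q : EuclideanSpace ℝ (Fin 2)) :
    (inner ℝ (a - p) (b - p) - (dist p O ^ 2 - r ^ 2)) * det2 (b - a) (q - a) =
      (inner ℝ (a - q) (b - q) - (dist q O ^ 2 - r ^ 2)) * det2 (b - a) (p - a) := by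
  have ha2 : dist a O ^ 2 = r ^ 2 := by rw [ha]
  have hb2 : dist b O ^ 2 = r ^ 2 := by rw [hb]
  rw [dist_eq_norm, norm_sq_eq_coords] at ha2 hb2 ⊢
  rw [dist_eq_norm, norm_sq_eq_coords, inner_eq_coords, inner_eq_coords]
  simp only [det2, PiLp.sub_apply] at ha2 hb2 ⊢
  linear_combination
    (((b 0 - a 0) * (p 1 - a 1) - (b 1 - a 1) * (p 0 - a 0)) -
        ((b 0 - a 0) * (q 1 - a 1) - (b 1 - a 1) * (q 0 - a 0))) * ha2 +
      ((p 0 - a 0) * (q 1 - a 1) - (p 1 - a 1) * (q 0 - a 0)) * (ha2 - hb2)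

/-- For `q` on the circle and `p` on the same side of the chord `ab`, the sign of the power of `p`
decides which of the two subtended angles has the larger cotangent. -/
theorem inner_mul_abs_det2_sub_eq {O a b : EuclideanSpace ℝ (Fin 2)} {r : ℝ}
    (ha : dist a O = r) (hb : dist b O = r) {p q : EuclideanSpace ℝ (Fin 2)}
    (hside : 0 < det2 (b - a) (p - a) * det2 (b - a) (q - a)) (hq : dist q O = r) :
    inner ℝ (a - p) (b - p) * |det2 (b - a) (q - a)| -
      inner ℝ (a - q) (b - q) * |det2 (b - a) (p - a)| =
      (dist p O ^ 2 - r ^ 2) * |det2 (b - a) (q - a)| := by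
  have h := inner_sub_power_mul_det2_eq ha hb p q
  rw [hq] at h
  rcases pos_and_pos_or_neg_and_neg_of_mul_pos hside with ⟨h1, h2⟩ | ⟨h1, h2⟩
  · rw [abs_of_pos h1, abs_of_pos h2]
    linear_combination h
  · rw [abs_of_neg h1, abs_of_neg h2]
    linear_combination -h


/-- Thales' theorem in the Euclidean plane. -/
theorem stmt17 (O : EuclideanSpace ℝ (Fin 2)) (r : ℝ) (hr : 0 < r)
    (p₁ p₂ p₃ p₄ p₅ : EuclideanSpace ℝ (Fin 2))
    (h1 : dist p₁ O = r) (h2 : dist p₂ O = r) (h3 : dist p₃ O = r)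
    (h12 : p₁ ≠ p₂) (h13 : p₁ ≠ p₃) (h23 : p₂ ≠ p₃)
    (h41 : p₄ ≠ p₁) (h42 : p₄ ≠ p₂) (h51 : p₅ ≠ p₁) (h52 : p₅ ≠ p₂)
    (hside4 : 0 < det2 (p₂ - p₁) (p₄ - p₁) * det2 (p₂ - p₁) (p₃ - p₁))
    (hside5 : 0 < det2 (p₂ - p₁) (p₅ - p₁) * det2 (p₂ - p₁) (p₃ - p₁))
    (hin : dist p₄ O < r) (hout : r < dist p₅ O) :
    EuclideanGeometry.angle p₁ p₄ p₂ > EuclideanGeometry.angle p₁ p₃ p₂ ∧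
      EuclideanGeometry.angle p₁ p₃ p₂ > EuclideanGeometry.angle p₁ p₅ p₂ := by
  have hd3 := right_ne_zero_of_mul hside4.ne'
  have hd4 := left_ne_zero_of_mul hside4.ne'
  have hd5 := left_ne_zero_of_mul hside5.ne'
  have h4 := inner_mul_abs_det2_sub_eq h1 h2 hside4 h3
  have h5 := inner_mul_abs_det2_sub_eq h1 h2 hside5 h3
  have hpow4 : dist p₄ O ^ 2 - r ^ 2 < 0 :=
    sub_neg.2 (pow_lt_pow_left₀ hin dist_nonneg two_ne_zero)
  have hpow5 : 0 < dist p₅ O ^ 2 - r ^ 2 := sub_pos.2 (pow_lt_pow_left₀ hout hr.le two_ne_zero)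
  exact ⟨angle_lt_angle_of_inner_mul_abs_det2_lt hd4 hd3
      (sub_neg.1 (h4 ▸ mul_neg_of_neg_of_pos hpow4 (abs_pos.2 hd3))),
    angle_lt_angle_of_inner_mul_abs_det2_lt hd3 hd5
      (sub_pos.1 (h5 ▸ mul_pos hpow5 (abs_pos.2 hd3)))⟩
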